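/- Let μ, ν ∈ P₁((0,∞)) with μ ≤_c ν, and let μ̂ be a Borel probability measure on (0,∞) × [0,1] with first marginal μ (so ∫ x dμ̂ < ∞) whose second marginal has no atoms. Then a coupling π ∈ M(μ,ν) minimizes π ↦ ∫ C^{μ̂}(π_{x₀}) dμ(x₀) over M(μ,ν) if and only if S(π) minimizes π̂ ↦ ∫ C^{Ŝ(μ̂)}(π̂_{y₀}) dS(μ)(y₀) over M(S(μ), S(ν)). In particular, if π^{μ̂} is the unique minimizer of the first problem (the shadow coupling between μ and ν with source μ̂), then S(π^{μ̂}) is the unique minimizer of the second problem (the shadow coupling between S(μ) and S(ν) with source Ŝ(μ̂)). -/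

import Mathlib

open MeasureTheory Set

/-- Barycenter of a measure on `ℝ`. -/
noncomputable def bary (mu : Measure ℝ) : ℝ := ∫ x, x ∂mu

/-- `mu ∈ P₁((0,∞))`: Borel probability measure on `ℝ` concentrated on `(0,∞)`
with finite first moment. -/
def MemP1 (mu : Measure ℝ) : Prop :=
  IsProbabilityMeasure mu ∧ mu (Set.Ioi (0:ℝ))ᶜ = 0 ∧ Integrable id mu

/-- Change-of-numeraire transform of a measure on `ℝ`:
`S(mu)(B) = (1/b(mu)) ∫ x · 1_B(1/x) dmu(x)`. -/
noncomputable def S (mu : Measure ℝ) : Measure ℝ :=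
  (ENNReal.ofReal (bary mu))⁻¹ •
    ((mu.withDensity fun x => ENNReal.ofReal x).map fun x => x⁻¹)

/-- Change-of-numeraire transform of a measure on `ℝ × ℝ`:
`S(π)(B) = (∫ x₁ · 1_B(1/x₀,1/x₁) dπ) / (∫ x₁ dπ)`. -/
noncomputable def S2 (pi : Measure (ℝ × ℝ)) : Measure (ℝ × ℝ) :=
  (ENNReal.ofReal (∫ p, p.2 ∂pi))⁻¹ •
    ((pi.withDensity fun p => ENNReal.ofReal p.2).map fun p => (p.1⁻¹, p.2⁻¹))

/-- `π ∈ M(μ,ν)`: martingale coupling of `μ` and `ν`, i.e. a probability measure on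
`(0,∞)²` with first marginal `μ`, second marginal `ν`, such that
`∫ f(x₀)(x₁ - x₀) dπ = 0` for all bounded Borel `f`. -/
def IsMC (mu nu : Measure ℝ) (pi : Measure (ℝ × ℝ)) : Prop :=
  IsProbabilityMeasure pi ∧
  pi ((Set.Ioi (0:ℝ) ×ˢ Set.Ioi (0:ℝ))ᶜ) = 0 ∧
  pi.map Prod.fst = mu ∧ pi.map Prod.snd = nu ∧
  ∀ f : ℝ → ℝ, Measurable f → (∃ M, ∀ x, |f x| ≤ M) →
    ∫ p, f p.1 * (p.2 - p.1) ∂pi = 0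


/-- Convex order: `∫ φ dμ ≤ ∫ φ dν` for every convex `φ` for which both integrals exist. -/
def ConvexOrder (mu nu : Measure ℝ) : Prop :=
  ∀ phi : ℝ → ℝ, ConvexOn ℝ Set.univ phi → Integrable phi mu → Integrable phi nu →
    ∫ x, phi x ∂mu ≤ ∫ x, phi x ∂nu

/-- Extended change-of-numeraire transform on measures on `(0,∞)² × [0,1]`
(coordinates `(x₀, x₁, u)`):
`Ŝ(π)(B) = (∫ x₁ · 1_B(1/x₀, 1/x₁, u) dπ) / (∫ x₁ dπ)`. -/
noncomputable def Shat (pi : Measure (ℝ × ℝ × ℝ)) : Measure (ℝ × ℝ × ℝ) :=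
  (ENNReal.ofReal (∫ p, p.2.1 ∂pi))⁻¹ •
    ((pi.withDensity fun p => ENNReal.ofReal p.2.1).map fun p => (p.1⁻¹, p.2.1⁻¹, p.2.2))

/-- Extended change-of-numeraire transform on measures on `(0,∞) × [0,1]`
(coordinates `(x, u)`): `Ŝ(μ̂)(B) = (∫ x · 1_B(1/x, u) dμ̂) / (∫ x dμ̂)`. -/
noncomputable def ShatMu (m : Measure (ℝ × ℝ)) : Measure (ℝ × ℝ) :=
  (ENNReal.ofReal (∫ p, p.1 ∂m))⁻¹ •
    ((m.withDensity fun p => ENNReal.ofReal p.1).map fun p => (p.1⁻¹, p.2))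

/-- A source: a Borel probability measure on `(0,∞) × [0,1]` with `∫ x dμ̂ < ∞`. -/
def MemSource (m : Measure (ℝ × ℝ)) : Prop :=
  IsProbabilityMeasure m ∧
  m {p : ℝ × ℝ | 0 < p.1 ∧ p.2 ∈ Set.Icc (0:ℝ) 1}ᶜ = 0 ∧
  Integrable (fun p => p.1) m

/-- A Borel probability measure on `(0,∞)² × [0,1]` with `∫ x₁ dπ < ∞`. -/
def GoodTriple (pi : Measure (ℝ × ℝ × ℝ)) : Prop :=
  IsProbabilityMeasure pi ∧
  pi {p : ℝ × ℝ × ℝ | 0 < p.1 ∧ 0 < p.2.1 ∧ p.2.2 ∈ Set.Icc (0:ℝ) 1}ᶜ = 0 ∧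
  Integrable (fun p => p.2.1) pi

/-- `π ∈ M̂`: probability measure on `(0,∞)² × [0,1]` with `∫ x₁ dπ < ∞` such that
`∫ g(x₀,u)(x₁ - x₀) dπ = 0` for all bounded Borel `g`. -/
def MemMhat (pi : Measure (ℝ × ℝ × ℝ)) : Prop :=
  GoodTriple pi ∧
  ∀ g : ℝ × ℝ → ℝ, Measurable g → (∃ M, ∀ q, |g q| ≤ M) →
    ∫ p, g (p.1, p.2.2) * (p.2.1 - p.1) ∂pi = 0

/-- `π ∈ M̂(μ̂, ν)`: lifted martingale transport plans with source `μ̂` and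
terminal marginal `ν`. -/
def MemMhatC (mhat : Measure (ℝ × ℝ)) (nu : Measure ℝ)
    (pi : Measure (ℝ × ℝ × ℝ)) : Prop :=
  MemMhat pi ∧
  pi.map (fun p => (p.1, p.2.2)) = mhat ∧
  pi.map (fun p => p.2.1) = nu
open scoped Classical in
/-- Disintegration (conditional kernel) of a measure on a product space with respect to the
first coordinate; equal to `Measure.condKernel` for finite measures. -/
noncomputable def disint {α β : Type*} [MeasurableSpace α] [MeasurableSpace β]
    [StandardBorelSpace β] [Nonempty β] (rho : Measure (α × β)) : α → Measure β :=
  if h : IsFiniteMeasure rho then (letI := h; fun a => rho.condKernel a)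
  else fun _ => 0


/-- The shadow cost `C^{μ̂}(η) = inf { ∫ (1-u)√(1+x₁²) dα : α ∈ M̂(δ_m ⊗ μ̂_m, η) }`
with `m = b(η)` and `μ̂_m` the disintegration of `μ̂` over its first marginal at `m`. -/
noncomputable def shadowCost (mhat : Measure (ℝ × ℝ)) (eta : Measure ℝ) : ENNReal :=
  sInf {r | ∃ alpha : Measure (ℝ × ℝ × ℝ),
    MemMhatC ((Measure.dirac (bary eta)).prod (disint mhat (bary eta))) eta alpha ∧
    r = ∫⁻ p, ENNReal.ofReal ((1 - p.2.2) * Real.sqrt (1 + p.2.1 ^ 2)) ∂alpha}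

/-- The total shadow cost `∫ C^{μ̂}(π_{x₀}) dbase(x₀)` of a coupling `π`. -/
noncomputable def shadowVal (mhat : Measure (ℝ × ℝ)) (base : Measure ℝ)
    (pi : Measure (ℝ × ℝ)) : ENNReal :=
  ∫⁻ x0, shadowCost mhat (disint pi x0) ∂base

/-- Reweight `P` by the normalised density `w` and push the result forward along `φ`. -/
noncomputable def numeraire {Ω Ω' : Type*} [MeasurableSpace Ω] [MeasurableSpace Ω']
    (w : Ω → ℝ) (φ : Ω → Ω') (P : Measure Ω) : Measure Ω' :=
  (ENNReal.ofReal (∫ p, w p ∂P))⁻¹ • ((P.withDensity fun p => ENNReal.ofReal (w p)).map φ)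

/-- The martingale property of `(X₀, X₁)` given `F`, tested against nonnegative functions. -/
def MartingaleGiven {Ω E : Type*} [MeasurableSpace Ω] [MeasurableSpace E]
    (P : Measure Ω) (X₀ X₁ : Ω → ℝ) (F : Ω → E) : Prop :=
  ∀ h : E → ENNReal, Measurable h →
    ∫⁻ p, ENNReal.ofReal (X₁ p) * h (F p) ∂P = ∫⁻ p, ENNReal.ofReal (X₀ p) * h (F p) ∂P

section Numeraire

variable {Ω Ω' E E' : Type*} [MeasurableSpace Ω] [MeasurableSpace Ω'] [MeasurableSpace E]
  [MeasurableSpace E'] {P : Measure Ω} {w : Ω → ℝ} {φ : Ω → Ω'}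

theorem lintegral_numeraire (hw : Measurable w) (hφ : Measurable φ) {f : Ω' → ENNReal}
    (hf : Measurable f) :
    ∫⁻ p, f p ∂(numeraire w φ P)
      = (ENNReal.ofReal (∫ p, w p ∂P))⁻¹ * ∫⁻ p, ENNReal.ofReal (w p) * f (φ p) ∂P := by
  rw [numeraire, lintegral_smul_measure, lintegral_map hf hφ,
    lintegral_withDensity_eq_lintegral_mul _ hw.ennreal_ofReal
      (by fun_prop : Measurable fun p => f (φ p))]
  rfl

theorem ae_numeraire (hφ : Measurable φ) {q : Ω' → Prop} (hq : MeasurableSet {x | q x})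
    (h : ∀ᵐ p ∂P, q (φ p)) : ∀ᵐ x ∂(numeraire w φ P), q x := by
  refine Measure.ae_smul_measure ?_ _
  rw [ae_map_iff hφ.aemeasurable hq]
  exact (withDensity_absolutelyContinuous _ _).ae_le h

theorem integral_pos_of_ae_pos [IsProbabilityMeasure P] (hint : Integrable w P)
    (hpos : ∀ᵐ p ∂P, 0 < w p) : 0 < ∫ p, w p ∂P := by
  rw [integral_pos_iff_support_of_nonneg_ae (hpos.mono fun p hp => hp.le) hint]
  have : Function.support w =ᵐ[P] Set.univ := by
    filter_upwards [hpos] with p hp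
    exact propext ⟨fun _ => trivial, fun _ => hp.ne'⟩
  rw [measure_congr this]
  simp

theorem isProbabilityMeasure_numeraire [IsProbabilityMeasure P] (hw : Measurable w)
    (hφ : Measurable φ) (hint : Integrable w P) (hpos : ∀ᵐ p ∂P, 0 < w p) :
    IsProbabilityMeasure (numeraire w φ P) := by
  constructor
  have h := lintegral_numeraire (P := P) hw hφ (f := fun _ => 1) measurable_const
  simp only [lintegral_one, mul_one] at h
  rw [h, ← ofReal_integral_eq_lintegral_ofReal hint (hpos.mono fun p hp => hp.le)]
  exact ENNReal.inv_mul_cancel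
    (by simpa using integral_pos_of_ae_pos hint hpos) ENNReal.ofReal_ne_top

theorem lintegral_ofReal_numeraire [IsProbabilityMeasure P] (hw : Measurable w)
    {φ : Ω → Ω} (hφ : Measurable φ) (hpos : ∀ᵐ p ∂P, 0 < w p) (hinv : ∀ p, w (φ p) = (w p)⁻¹) :
    ∫⁻ p, ENNReal.ofReal (w p) ∂(numeraire w φ P) = (ENNReal.ofReal (∫ p, w p ∂P))⁻¹ := by
  rw [lintegral_numeraire hw hφ hw.ennreal_ofReal]
  have : ∫⁻ p, ENNReal.ofReal (w p) * ENNReal.ofReal (w (φ p)) ∂P = ∫⁻ p, 1 ∂P := by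
    refine lintegral_congr_ae (hpos.mono fun p hp => ?_)
    simp only [hinv]
    rw [← ENNReal.ofReal_mul hp.le, mul_inv_cancel₀ hp.ne', ENNReal.ofReal_one]
  rw [this]
  simp

theorem ae_pos_numeraire (hw : Measurable w) {φ : Ω → Ω} (hφ : Measurable φ)
    (hpos : ∀ᵐ p ∂P, 0 < w p) (hinv : ∀ p, w (φ p) = (w p)⁻¹) :
    ∀ᵐ p ∂(numeraire w φ P), 0 < w p := by
  refine ae_numeraire hφ (measurableSet_lt measurable_const hw) (hpos.mono fun p hp => ?_)
  rw [hinv]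
  exact inv_pos.2 hp

theorem integrable_numeraire [IsProbabilityMeasure P] (hw : Measurable w)
    {φ : Ω → Ω} (hφ : Measurable φ) (hint : Integrable w P) (hpos : ∀ᵐ p ∂P, 0 < w p)
    (hinv : ∀ p, w (φ p) = (w p)⁻¹) : Integrable w (numeraire w φ P) := by
  refine (lintegral_ofReal_ne_top_iff_integrable hw.aestronglyMeasurable
    ((ae_pos_numeraire hw hφ hpos hinv).mono fun p hp => hp.le)).1 ?_
  rw [lintegral_ofReal_numeraire hw hφ hpos hinv]
  simpa using integral_pos_of_ae_pos hint hpos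

theorem integral_numeraire [IsProbabilityMeasure P] (hw : Measurable w)
    {φ : Ω → Ω} (hφ : Measurable φ) (hint : Integrable w P) (hpos : ∀ᵐ p ∂P, 0 < w p)
    (hinv : ∀ p, w (φ p) = (w p)⁻¹) :
    ∫ p, w p ∂(numeraire w φ P) = (∫ p, w p ∂P)⁻¹ := by
  rw [integral_eq_lintegral_of_nonneg_ae
    ((ae_pos_numeraire hw hφ hpos hinv).mono fun p hp => hp.le) hw.aestronglyMeasurable,
    lintegral_ofReal_numeraire hw hφ hpos hinv, ENNReal.toReal_inv,
    ENNReal.toReal_ofReal (integral_pos_of_ae_pos hint hpos).le]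

theorem numeraire_numeraire [IsProbabilityMeasure P] (hw : Measurable w)
    {φ : Ω → Ω} (hφ : Measurable φ) (hint : Integrable w P) (hpos : ∀ᵐ p ∂P, 0 < w p)
    (hinv : ∀ p, w (φ p) = (w p)⁻¹) (hφφ : ∀ p, φ (φ p) = p) :
    numeraire w φ (numeraire w φ P) = P := by
  have hb := integral_pos_of_ae_pos hint hpos
  refine Measure.ext_of_lintegral _ fun f hf => ?_
  rw [lintegral_numeraire hw hφ hf, integral_numeraire hw hφ hint hpos hinv,
    lintegral_numeraire hw hφ
      (by fun_prop : Measurable fun p => ENNReal.ofReal (w p) * f (φ p)), ← mul_assoc,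
    ← ENNReal.ofReal_inv_of_pos (inv_pos.2 hb), inv_inv, ENNReal.mul_inv_cancel
      (by simpa using hb) ENNReal.ofReal_ne_top, one_mul]
  refine lintegral_congr_ae (hpos.mono fun p hp => ?_)
  simp only [hinv, hφφ]
  rw [← mul_assoc, ← ENNReal.ofReal_mul hp.le, mul_inv_cancel₀ hp.ne', ENNReal.ofReal_one,
    one_mul]

theorem map_numeraire {G : Ω' → E'} {F : Ω → E} {ψ : E → E'} {v : E → ℝ} (hφ : Measurable φ)
    (hw : Measurable w) (hG : Measurable G) (hF : Measurable F) (hψ : Measurable ψ)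
    (hv : Measurable v) (hwv : ∀ p, w p = v (F p)) (hcomm : ∀ p, G (φ p) = ψ (F p)) :
    (numeraire w φ P).map G = numeraire v ψ (P.map F) := by
  refine Measure.ext_of_lintegral _ fun f hf => ?_
  rw [lintegral_map hf hG, lintegral_numeraire hw hφ (by fun_prop : Measurable fun p => f (G p)), lintegral_numeraire hv hψ hf,
    lintegral_map (by fun_prop : Measurable fun e => ENNReal.ofReal (v e) * f (ψ e)) hF,
    integral_map hF.aemeasurable hv.aestronglyMeasurable]
  simp only [hwv, hcomm]

theorem MartingaleGiven.map_numeraire {X₀ X₁ : Ω → ℝ} {F : Ω → E} {G : Ω' → E'} {ψ : E → E'}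
    {v : E → ℝ} (h : MartingaleGiven P X₀ X₁ F) (hX₁ : Measurable X₁) (hφ : Measurable φ)
    (hG : Measurable G) (hF : Measurable F) (hψ : Measurable ψ) (hv : Measurable v)
    (hv₀ : ∀ p, X₀ p = v (F p)) (hcomm : ∀ p, G (φ p) = ψ (F p))
    (heq : ∫ p, X₁ p ∂P = ∫ p, X₀ p ∂P) :
    (numeraire X₁ φ P).map G = numeraire v ψ (P.map F) := by
  refine Measure.ext_of_lintegral _ fun f hf => ?_
  rw [lintegral_map hf hG, lintegral_numeraire hX₁ hφ (by fun_prop : Measurable fun p => f (G p)), lintegral_numeraire hv hψ hf,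
    lintegral_map (by fun_prop : Measurable fun e => ENNReal.ofReal (v e) * f (ψ e)) hF,
    integral_map hF.aemeasurable hv.aestronglyMeasurable, heq]
  simp only [hcomm]
  rw [h (fun e => f (ψ e)) (hf.comp hψ)]
  simp only [hv₀]

theorem MartingaleGiven.numeraire {X₀ X₁ : Ω → ℝ} {F : Ω → E} {φ : Ω → Ω} {ψ : E → E}
    {v : E → ℝ} (h : MartingaleGiven P X₀ X₁ F) (hX₀ : Measurable X₀) (hX₁ : Measurable X₁)
    (hφ : Measurable φ) (hF : Measurable F) (hψ : Measurable ψ) (hv : Measurable v)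
    (hv₀ : ∀ p, X₀ p = v (F p)) (hcomm : ∀ p, F (φ p) = ψ (F p))
    (hinv₀ : ∀ p, X₀ (φ p) = (X₀ p)⁻¹) (hinv₁ : ∀ p, X₁ (φ p) = (X₁ p)⁻¹)
    (hpos₀ : ∀ᵐ p ∂P, 0 < X₀ p) (hpos₁ : ∀ᵐ p ∂P, 0 < X₁ p) :
    MartingaleGiven (numeraire X₁ φ P) X₀ X₁ F := by
  intro f hf
  rw [lintegral_numeraire hX₁ hφ
      (by fun_prop : Measurable fun p => ENNReal.ofReal (X₁ p) * f (F p)),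
    lintegral_numeraire hX₁ hφ
      (by fun_prop : Measurable fun p => ENNReal.ofReal (X₀ p) * f (F p))]
  congr 1
  simp only [hinv₀, hinv₁, hcomm]
  have h1 := h (fun e => ENNReal.ofReal (v e)⁻¹ * f (ψ e))
    (hv.inv.ennreal_ofReal.mul (hf.comp hψ))
  simp only [← hv₀] at h1
  rw [h1]
  refine lintegral_congr_ae ?_
  filter_upwards [hpos₀, hpos₁] with p h0 h1
  rw [← mul_assoc, ← mul_assoc, ← ENNReal.ofReal_mul h0.le, ← ENNReal.ofReal_mul h1.le,
    mul_inv_cancel₀ h0.ne', mul_inv_cancel₀ h1.ne']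

theorem integral_comp_mul_eq {X : Ω → ℝ} {F : Ω → E} {g : E → ℝ} (hX : Measurable X)
    (hF : Measurable F) (hpos : ∀ᵐ p ∂P, 0 < X p) (hg : Measurable g) :
    ∫ p, g (F p) * X p ∂P = ∫ e, g e ∂((P.withDensity fun p => ENNReal.ofReal (X p)).map F) := by
  rw [integral_map hF.aemeasurable hg.aestronglyMeasurable,
    integral_withDensity_eq_integral_toReal_smul hX.ennreal_ofReal
      (Filter.Eventually.of_forall fun _ => ENNReal.ofReal_lt_top)]
  refine integral_congr_ae (hpos.mono fun p hp => ?_)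
  simp [ENNReal.toReal_ofReal hp.le, mul_comm]

theorem martingaleGiven_iff {X₀ X₁ : Ω → ℝ} {F : Ω → E} (hX₀ : Measurable X₀)
    (hX₁ : Measurable X₁) (hF : Measurable F) (hpos₀ : ∀ᵐ p ∂P, 0 < X₀ p)
    (hpos₁ : ∀ᵐ p ∂P, 0 < X₁ p) (hint₀ : Integrable X₀ P) (hint₁ : Integrable X₁ P) :
    MartingaleGiven P X₀ X₁ F ↔ ∀ g : E → ℝ, Measurable g → (∃ M, ∀ e, |g e| ≤ M) →
      ∫ p, g (F p) * (X₁ p - X₀ p) ∂P = 0 := by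
  have key : ∀ g : E → ℝ, Measurable g → (∃ M, ∀ e, |g e| ≤ M) →
      ∫ p, g (F p) * (X₁ p - X₀ p) ∂P
        = ∫ e, g e ∂((P.withDensity fun p => ENNReal.ofReal (X₁ p)).map F)
          - ∫ e, g e ∂((P.withDensity fun p => ENNReal.ofReal (X₀ p)).map F) := by
    rintro g hg ⟨M, hM⟩
    have hb : ∀ᵐ p ∂P, ‖g (F p)‖ ≤ M := Filter.Eventually.of_forall fun p => hM _
    have hgF : Measurable fun p => g (F p) := hg.comp hF
    rw [← integral_comp_mul_eq hX₁ hF hpos₁ hg, ← integral_comp_mul_eq hX₀ hF hpos₀ hg,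
      ← integral_sub (hint₁.bdd_mul hgF.aestronglyMeasurable hb)
        (hint₀.bdd_mul hgF.aestronglyMeasurable hb)]
    simp only [mul_sub]
  have hlin : ∀ X : Ω → ℝ, Measurable X → ∀ f : E → ENNReal, Measurable f →
      ∫⁻ e, f e ∂((P.withDensity fun p => ENNReal.ofReal (X p)).map F)
        = ∫⁻ p, ENNReal.ofReal (X p) * f (F p) ∂P := by
    intro X hX f hf
    rw [lintegral_map hf hF,
      lintegral_withDensity_eq_lintegral_mul _ hX.ennreal_ofReal
        (by fun_prop : Measurable fun p => f (F p))]
    rfl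
  constructor
  · intro h g hg hM
    have hmeas : (P.withDensity fun p => ENNReal.ofReal (X₁ p)).map F
        = (P.withDensity fun p => ENNReal.ofReal (X₀ p)).map F :=
      Measure.ext_of_lintegral _ fun f hf => by
        rw [hlin _ hX₁ _ hf, hlin _ hX₀ _ hf, h f hf]
    rw [key g hg hM, hmeas, sub_self]
  · intro h f hf
    rw [← hlin _ hX₁ _ hf, ← hlin _ hX₀ _ hf]
    have hfin : ∀ X : Ω → ℝ, Integrable X P →
        IsFiniteMeasure ((P.withDensity fun p => ENNReal.ofReal (X p)).map F) := by
      intro X hX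
      have := isFiniteMeasure_withDensity_ofReal hX.2
      infer_instance
    have := hfin X₀ hint₀
    have := hfin X₁ hint₁
    congr 1
    ext s hs
    have h1 := key (s.indicator 1) (measurable_one.indicator hs)
      ⟨1, fun e => by by_cases he : e ∈ s <;> simp [he]⟩
    rw [h _ (measurable_one.indicator hs)
      ⟨1, fun e => by by_cases he : e ∈ s <;> simp [he]⟩, integral_indicator_one hs,
      integral_indicator_one hs, eq_comm, sub_eq_zero] at h1
    exact (measureReal_eq_measureReal_iff).1 h1

theorem MartingaleGiven.integral_eq {X₀ X₁ : Ω → ℝ} {F : Ω → E}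
    (h : MartingaleGiven P X₀ X₁ F) (hX₀ : Measurable X₀)
    (hX₁ : Measurable X₁) (hpos₀ : ∀ᵐ p ∂P, 0 < X₀ p) (hpos₁ : ∀ᵐ p ∂P, 0 < X₁ p) :
    ∫ p, X₁ p ∂P = ∫ p, X₀ p ∂P := by
  rw [integral_eq_lintegral_of_nonneg_ae (hpos₀.mono fun p hp => hp.le) hX₀.aestronglyMeasurable,
    integral_eq_lintegral_of_nonneg_ae (hpos₁.mono fun p hp => hp.le) hX₁.aestronglyMeasurable]
  simpa using congrArg ENNReal.toReal (h (fun _ => 1) measurable_const)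

end Numeraire

theorem ae_of_ae_numeraire {Ω Ω' : Type*} [MeasurableSpace Ω] [MeasurableSpace Ω']
    {P : Measure Ω} {w : Ω → ℝ} {φ : Ω → Ω'} (hw : Measurable w) (hφ : Measurable φ)
    (hpos : ∀ᵐ p ∂P, 0 < w p) {q : Ω' → Prop} (h : ∀ᵐ y ∂(numeraire w φ P), q y) :
    ∀ᵐ p ∂P, q (φ p) := by
  rw [numeraire, Measure.ae_ennreal_smul_measure_iff (by simp)] at h
  have h1 := ae_of_ae_map hφ.aemeasurable h
  rw [ae_withDensity_iff hw.ennreal_ofReal] at h1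
  filter_upwards [h1, hpos] with p hp hwp
  exact hp (by simpa using hwp)

section Disintegration

variable {β β' : Type*} [MeasurableSpace β] [StandardBorelSpace β] [Nonempty β]
  [MeasurableSpace β'] [StandardBorelSpace β'] [Nonempty β']

theorem disint_eq_condKernel {α : Type*} [MeasurableSpace α] (P : Measure (α × β))
    [h : IsFiniteMeasure P] (a : α) : disint P a = P.condKernel a := by
  simp [disint, h]

theorem ae_ae_condKernel {α : Type*} [MeasurableSpace α] {P : Measure (α × β)}
    [IsFiniteMeasure P] {q : α × β → Prop} (h : ∀ᵐ p ∂P, q p) :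
    ∀ᵐ x ∂P.fst, ∀ᵐ b ∂(P.condKernel x), q (x, b) := by
  rw [← P.disintegrate P.condKernel] at h
  exact Measure.ae_ae_of_ae_compProd h

theorem MartingaleGiven.lintegral_condKernel {P : Measure (ℝ × β)} [IsFiniteMeasure P]
    {w : ℝ × β → ℝ} (hw : Measurable w) (h : MartingaleGiven P Prod.fst w Prod.fst) :
    ∀ᵐ x ∂P.fst, ∫⁻ b, ENNReal.ofReal (w (x, b)) ∂(P.condKernel x) = ENNReal.ofReal x := by
  refine ae_eq_of_forall_setLIntegral_eq_of_sigmaFinite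
    (Measurable.lintegral_kernel_prod_right' (f := fun p => ENNReal.ofReal (w p))
      hw.ennreal_ofReal) measurable_id.ennreal_ofReal fun s hs _ => ?_
  have h1 := h (s.indicator 1) (measurable_one.indicator hs)
  have key : ∀ X : ℝ × β → ℝ, ∫⁻ p, ENNReal.ofReal (X p) * s.indicator 1 p.1 ∂P
      = ∫⁻ p in Prod.fst ⁻¹' s, ENNReal.ofReal (X p) ∂P := by
    intro X
    rw [← lintegral_indicator (measurable_fst hs)]
    refine lintegral_congr fun p => ?_
    by_cases hp : p.1 ∈ s <;> simp [hp]
  rw [key, key] at h1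
  have h2 := Measure.setLIntegral_condKernel_univ_right (ρ := P)
    (f := fun p => ENNReal.ofReal (w p)) (by fun_prop) hs
  rw [h2, Set.prod_univ, h1, Measure.fst, setLIntegral_map hs (by fun_prop) measurable_fst]

theorem disint_numeraire {P : Measure (ℝ × β)} [IsProbabilityMeasure P] {w : ℝ × β → ℝ}
    {g : β → β'} (hw : Measurable w) (hg : Measurable g)
    (hint : Integrable w P) (hpos : ∀ᵐ p ∂P, 0 < w p) (hpos₀ : ∀ᵐ p ∂P, 0 < p.1)
    (h : MartingaleGiven P Prod.fst w Prod.fst) :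
    ∀ᵐ x ∂P.fst, disint (numeraire w (fun p => (p.1⁻¹, g p.2)) P) x⁻¹
      = (ENNReal.ofReal x)⁻¹ •
        ((P.condKernel x).withDensity fun b => ENNReal.ofReal (w (x, b))).map g := by
  have hφ : Measurable fun p : ℝ × β => (p.1⁻¹, g p.2) := by fun_prop
  have := isProbabilityMeasure_numeraire hw hφ hint hpos
  set ρ := numeraire w (fun p : ℝ × β => (p.1⁻¹, g p.2)) P
  have hposf : ∀ᵐ x ∂P.fst, 0 < x := by
    rw [Measure.fst, ae_map_iff measurable_fst.aemeasurable measurableSet_Ioi]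
    exact hpos₀
  have hfst : ρ.fst = numeraire id (fun x => x⁻¹) P.fst :=
    h.map_numeraire hw hφ measurable_fst measurable_fst measurable_inv measurable_id
      (fun _ => rfl) (fun _ => rfl) (h.integral_eq measurable_fst hw hpos₀ hpos)
  have hcost := h.integral_eq measurable_fst hw hpos₀ hpos
  have hcond := h.lintegral_condKernel hw
  let d : ℝ → β → ENNReal := fun x b => (ENNReal.ofReal x)⁻¹ * ENNReal.ofReal (w (x, b))
  have hd : Measurable (Function.uncurry d) := by
    have : Measurable fun p : ℝ × β => (ENNReal.ofReal p.1)⁻¹ * ENNReal.ofReal (w p) := by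
      fun_prop
    exact this
  let κ₁ := ProbabilityTheory.Kernel.withDensity P.condKernel d
  have hA : MeasurableSet {x | κ₁ x univ = 1} :=
    (ProbabilityTheory.Kernel.measurable_coe κ₁ .univ) (measurableSet_singleton 1)
  classical
  let κ₂ := ProbabilityTheory.Kernel.piecewise hA κ₁ P.condKernel
  have : ProbabilityTheory.IsMarkovKernel κ₂ := by
    refine ⟨fun x => ⟨?_⟩⟩
    rw [ProbabilityTheory.Kernel.piecewise_apply]
    split_ifs with hx
    · exact hx
    · exact measure_univ
  let κ₃ := (κ₂.comap (fun x : ℝ => x⁻¹) measurable_inv).map g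
  have hκ₁ : ∀ x, κ₁ x = (ENNReal.ofReal x)⁻¹ •
      (P.condKernel x).withDensity fun b => ENNReal.ofReal (w (x, b)) := by
    intro x
    rw [ProbabilityTheory.Kernel.withDensity_apply _ hd,
      ← withDensity_smul _ (by fun_prop : Measurable fun b => ENNReal.ofReal (w (x, b)))]
    rfl
  have hκ₂ : ∀ᵐ x ∂P.fst, κ₂ x = κ₁ x := by
    filter_upwards [hcond, hposf] with x hx hx0
    rw [ProbabilityTheory.Kernel.piecewise_apply, if_pos]
    change κ₁ x univ = 1
    rw [hκ₁, Measure.smul_apply, withDensity_apply _ .univ, setLIntegral_univ, hx]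
    exact ENNReal.inv_mul_cancel (by simpa using hx0) ENNReal.ofReal_ne_top
  have hκ₃ : ∀ x, κ₃ x⁻¹ = (κ₂ x).map g := by
    intro x
    rw [ProbabilityTheory.Kernel.map_apply _ hg, ProbabilityTheory.Kernel.comap_apply, inv_inv]
  have hκ₃' : ρ = ρ.fst.compProd κ₃ := by
    refine Measure.ext_of_lintegral _ fun f hf => ?_
    have hF : Measurable fun x => ∫⁻ b, f (x, b) ∂(κ₃ x) :=
      Measurable.lintegral_kernel_prod_right' hf
    rw [Measure.lintegral_compProd hf, hfst, lintegral_numeraire measurable_id measurable_inv hF,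
      lintegral_numeraire hw hφ hf, hcost, ← Measure.lintegral_condKernel (by fun_prop),
      Measure.fst, integral_map measurable_fst.aemeasurable
        measurable_id.aestronglyMeasurable]
    congr 1
    refine lintegral_congr_ae ?_
    filter_upwards [hκ₂, hposf] with x hx hx0
    rw [hκ₃, hx, lintegral_map (by fun_prop) hg, hκ₁, lintegral_smul_measure,
      lintegral_withDensity_eq_lintegral_mul _ (by fun_prop) (by fun_prop), smul_eq_mul,
      ← mul_assoc, id, ENNReal.mul_inv_cancel (by simpa using hx0) ENNReal.ofReal_ne_top, one_mul]
    rfl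
  have huniq := ProbabilityTheory.eq_condKernel_of_measure_eq_compProd κ₃ hκ₃'
  rw [hfst] at huniq
  filter_upwards [ae_of_ae_numeraire measurable_id measurable_inv hposf huniq, hκ₂] with x hx hx2
  rw [disint_eq_condKernel, ← hx, hκ₃, hx2, hκ₁, Measure.map_smul]

end Disintegration

section ChangeOfNumeraire

theorem MemP1.ae_pos {mu : Measure ℝ} (h : MemP1 mu) : ∀ᵐ x ∂mu, 0 < x := h.2.1

theorem MemP1.bary_pos {mu : Measure ℝ} (h : MemP1 mu) : 0 < bary mu :=
  have := h.1
  integral_pos_of_ae_pos h.2.2 h.ae_pos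

theorem MemP1.map_S {mu : Measure ℝ} (h : MemP1 mu) : MemP1 (S mu) :=
  have := h.1
  ⟨isProbabilityMeasure_numeraire measurable_id measurable_inv h.2.2 h.ae_pos,
    ae_pos_numeraire (w := id) measurable_id measurable_inv h.ae_pos fun _ => rfl,
    integrable_numeraire measurable_id measurable_inv h.2.2 h.ae_pos fun _ => rfl⟩

theorem MemP1.bary_S {mu : Measure ℝ} (h : MemP1 mu) : bary (S mu) = (bary mu)⁻¹ :=
  have := h.1
  integral_numeraire measurable_id measurable_inv h.2.2 h.ae_pos fun _ => rfl

theorem MemP1.S_S {mu : Measure ℝ} (h : MemP1 mu) : S (S mu) = mu :=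
  have := h.1
  numeraire_numeraire measurable_id measurable_inv h.2.2 h.ae_pos (fun _ => rfl) inv_inv

theorem measurable_inv_inv_id :
    Measurable fun p : ℝ × ℝ × ℝ => (p.1⁻¹, p.2.1⁻¹, p.2.2) := by fun_prop

/-- The numeraire change maps lifted plans with a Dirac first marginal to such plans. -/
theorem MemMhatC.map_Shat {x : ℝ} (hx : 0 < x) {κ : Measure ℝ} [IsProbabilityMeasure κ]
    {eta : Measure ℝ} {alpha : Measure (ℝ × ℝ × ℝ)}
    (h : MemMhatC ((Measure.dirac x).prod κ) eta alpha) :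
    MemMhatC ((Measure.dirac x⁻¹).prod κ) (S eta) (Shat alpha) ∧ ∫ p, p.2.1 ∂alpha = x := by
  obtain ⟨⟨⟨hprob, hsupp, hint⟩, hmart⟩, hF, hsnd⟩ := h
  have hsupp' : ∀ᵐ p : ℝ × ℝ × ℝ ∂alpha, 0 < p.1 ∧ 0 < p.2.1 ∧ p.2.2 ∈ Set.Icc (0:ℝ) 1 := hsupp
  have hmF : Measurable fun p : ℝ × ℝ × ℝ => (p.1, p.2.2) := by fun_prop
  have hm0 : Measurable fun p : ℝ × ℝ × ℝ => p.1 := by fun_prop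
  have hm1 : Measurable fun p : ℝ × ℝ × ℝ => p.2.1 := by fun_prop
  have hφ := measurable_inv_inv_id
  have hpos0 := hsupp'.mono fun p hp => hp.1
  have hpos1 := hsupp'.mono fun p hp => hp.2.1
  have hmap : alpha.map (fun p => p.1) = Measure.dirac x := by
    have := congrArg Measure.fst hF
    rwa [Measure.fst_prod, Measure.fst, Measure.map_map measurable_fst hmF] at this
  have hx0 : ∀ᵐ p ∂alpha, p.1 = x := by
    refine ae_of_ae_map hm0.aemeasurable (p := fun y => y = x) ?_
    rw [hmap]
    exact (ae_dirac_iff (measurableSet_singleton x)).2 rfl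
  have hint0 : Integrable (fun p : ℝ × ℝ × ℝ => p.1) alpha :=
    (integrable_const x).congr (hx0.mono fun p hp => hp.symm)
  have hM : MartingaleGiven alpha (fun p => p.1) (fun p => p.2.1) (fun p => (p.1, p.2.2)) :=
    (martingaleGiven_iff hm0 hm1 hmF hpos0 hpos1 hint0 hint).2 hmart
  have hbar := hM.integral_eq hm0 hm1 hpos0 hpos1
  have hmean : ∫ p, p.1 ∂alpha = x := by
    rw [integral_congr_ae hx0]
    simp
  have hprob' : IsProbabilityMeasure (Shat alpha) :=
    isProbabilityMeasure_numeraire hm1 hφ hint hpos1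
  have hF' : (Shat alpha).map (fun p => (p.1, p.2.2)) = (Measure.dirac x⁻¹).prod κ := by
    have h1 := hM.map_numeraire (ψ := fun q : ℝ × ℝ => (q.1⁻¹, q.2)) (v := Prod.fst) hm1 hφ
      hmF hmF (by fun_prop) measurable_fst (fun _ => rfl) (fun _ => rfl) hbar
    refine h1.trans ?_
    rw [hF]
    refine Measure.ext_of_lintegral _ fun f hf => ?_
    have hmean' : ∫ p, p.1 ∂((Measure.dirac x).prod κ) = x := by
      rw [← hF, integral_map hmF.aemeasurable measurable_fst.aestronglyMeasurable, hmean]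
    rw [lintegral_numeraire measurable_fst (by fun_prop) hf, hmean',
      lintegral_prod _ (by fun_prop), lintegral_dirac, lintegral_prod _ (by fun_prop),
      lintegral_dirac]
    simp only
    rw [lintegral_const_mul _ (by fun_prop), ← mul_assoc,
      ENNReal.inv_mul_cancel (by simpa using hx) ENNReal.ofReal_ne_top, one_mul]
  have hint0' : Integrable (fun p : ℝ × ℝ × ℝ => p.1) (Shat alpha) := by
    have hx0' : ∀ᵐ p ∂(Shat alpha), p.1 = x⁻¹ :=
      ae_numeraire hφ (measurableSet_eq_fun hm0 measurable_const)
        (hx0.mono fun p hp => by simp [hp])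
    exact (integrable_const x⁻¹).congr (hx0'.mono fun p hp => hp.symm)
  have hsupp'' : ∀ᵐ p ∂(Shat alpha), 0 < p.1 ∧ 0 < p.2.1 ∧ p.2.2 ∈ Set.Icc (0:ℝ) 1 := by
    refine ae_numeraire hφ ?_ (hsupp'.mono fun p hp => by simpa using hp)
    exact (measurableSet_lt measurable_const hm0).inter
      ((measurableSet_lt measurable_const hm1).inter
        ((by fun_prop : Measurable fun p : ℝ × ℝ × ℝ => p.2.2) measurableSet_Icc))
  have hint' : Integrable (fun p : ℝ × ℝ × ℝ => p.2.1) (Shat alpha) :=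
    integrable_numeraire hm1 hφ hint hpos1 fun _ => rfl
  refine ⟨⟨⟨⟨hprob', hsupp'', hint'⟩, ?_⟩, hF', ?_⟩, hbar.trans hmean⟩
  · refine (martingaleGiven_iff hm0 hm1 hmF (hsupp''.mono fun p hp => hp.1)
      (hsupp''.mono fun p hp => hp.2.1) hint0' hint').1 ?_
    exact hM.numeraire (ψ := fun q : ℝ × ℝ => (q.1⁻¹, q.2)) (v := Prod.fst) hm0 hm1 hφ hmF
      (by fun_prop) measurable_fst (fun _ => rfl) (fun _ => rfl) (fun _ => rfl) (fun _ => rfl)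
      hpos0 hpos1
  · rw [← hsnd]
    exact map_numeraire (v := id) hφ hm1 hm1 hm1 measurable_inv measurable_id (fun _ => rfl)
      fun _ => rfl

theorem lintegral_cost_Shat {x : ℝ} (hx : 0 < x) {alpha : Measure (ℝ × ℝ × ℝ)}
    (hpos : ∀ᵐ p ∂alpha, 0 < p.2.1) (hmean : ∫ p, p.2.1 ∂alpha = x) :
    ENNReal.ofReal x *
        ∫⁻ p, ENNReal.ofReal ((1 - p.2.2) * Real.sqrt (1 + p.2.1 ^ 2)) ∂(Shat alpha)
      = ∫⁻ p, ENNReal.ofReal ((1 - p.2.2) * Real.sqrt (1 + p.2.1 ^ 2)) ∂alpha := by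
  have h1 := lintegral_numeraire (P := alpha) (w := fun p => p.2.1)
    (by fun_prop) measurable_inv_inv_id
    (f := fun p => ENNReal.ofReal ((1 - p.2.2) * Real.sqrt (1 + p.2.1 ^ 2))) (by fun_prop)
  rw [hmean] at h1
  refine (congrArg (ENNReal.ofReal x * ·) h1).trans ?_
  simp only
  rw [← mul_assoc, ENNReal.mul_inv_cancel (by simpa using hx) ENNReal.ofReal_ne_top, one_mul]
  refine lintegral_congr_ae (hpos.mono fun p hp => ?_)
  simp only
  rw [← ENNReal.ofReal_mul hp.le]
  congr 1
  have hsq : p.2.1 * Real.sqrt (1 + p.2.1⁻¹ ^ 2) = Real.sqrt (1 + p.2.1 ^ 2) := by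
    nth_rewrite 1 [← Real.sqrt_sq hp.le]
    rw [← Real.sqrt_mul (sq_nonneg _)]
    congr 1
    field_simp
    ring
  rw [← hsq]
  ring

theorem ofReal_mul_shadowCost_le {m m' : Measure (ℝ × ℝ)} {eta : Measure ℝ} (heta : MemP1 eta)
    (hm : IsProbabilityMeasure (disint m (bary eta)))
    (hdis : disint m' (bary eta)⁻¹ = disint m (bary eta)) :
    ENNReal.ofReal (bary eta) * shadowCost m' (S eta) ≤ shadowCost m eta := by
  refine le_sInf ?_
  rintro r ⟨alpha, halpha, rfl⟩
  obtain ⟨h1, h2⟩ := halpha.map_Shat heta.bary_pos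
  have hsupp : ∀ᵐ p : ℝ × ℝ × ℝ ∂alpha, 0 < p.1 ∧ 0 < p.2.1 ∧ p.2.2 ∈ Set.Icc (0:ℝ) 1 :=
    halpha.1.1.2.1
  rw [← lintegral_cost_Shat heta.bary_pos (hsupp.mono fun p hp => hp.2.1) h2]
  gcongr
  refine sInf_le ⟨Shat alpha, ?_, rfl⟩
  rwa [heta.bary_S, hdis]

theorem ofReal_mul_shadowCost_S {m m' : Measure (ℝ × ℝ)} {eta : Measure ℝ} (heta : MemP1 eta)
    (hm : IsProbabilityMeasure (disint m (bary eta)))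
    (hdis : disint m' (bary eta)⁻¹ = disint m (bary eta)) :
    ENNReal.ofReal (bary eta) * shadowCost m' (S eta) = shadowCost m eta := by
  refine le_antisymm (ofReal_mul_shadowCost_le heta hm hdis) ?_
  have h := ofReal_mul_shadowCost_le (m := m') (m' := m) heta.map_S
    (by rwa [heta.bary_S, hdis]) (by rw [heta.bary_S, inv_inv, hdis])
  rw [heta.S_S, heta.bary_S, ENNReal.ofReal_inv_of_pos heta.bary_pos] at h
  exact (ENNReal.inv_mul_le_iff (by simpa using heta.bary_pos) ENNReal.ofReal_ne_top).1 h

theorem measurable_inv_prod_inv : Measurable fun p : ℝ × ℝ => (p.1⁻¹, p.2⁻¹) := by fun_prop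

namespace IsMC

variable {mu nu : Measure ℝ} {pi : Measure (ℝ × ℝ)}

theorem ae_pos (h : IsMC mu nu pi) : ∀ᵐ p ∂pi, 0 < p.1 ∧ 0 < p.2 := h.2.1

theorem integrable_fst (h : IsMC mu nu pi) (hmu : MemP1 mu) : Integrable Prod.fst pi := by
  have := hmu.2.2
  rw [← h.2.2.1] at this
  exact this.comp_measurable measurable_fst

theorem integrable_snd (h : IsMC mu nu pi) (hnu : MemP1 nu) : Integrable Prod.snd pi := by
  have := hnu.2.2
  rw [← h.2.2.2.1] at this
  exact this.comp_measurable measurable_snd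

theorem martingaleGiven (h : IsMC mu nu pi) (hmu : MemP1 mu) (hnu : MemP1 nu) :
    MartingaleGiven pi Prod.fst Prod.snd Prod.fst :=
  (martingaleGiven_iff measurable_fst measurable_snd measurable_fst
    (h.ae_pos.mono fun _ hp => hp.1) (h.ae_pos.mono fun _ hp => hp.2)
    (h.integrable_fst hmu) (h.integrable_snd hnu)).2 h.2.2.2.2

theorem S2_S2 (h : IsMC mu nu pi) (hnu : MemP1 nu) : S2 (S2 pi) = pi :=
  have := h.1
  numeraire_numeraire measurable_snd measurable_inv_prod_inv (h.integrable_snd hnu)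
    (h.ae_pos.mono fun _ hp => hp.2) (fun _ => rfl) fun p => by simp

theorem map_S2 (h : IsMC mu nu pi) (hmu : MemP1 mu) (hnu : MemP1 nu) :
    IsMC (S mu) (S nu) (S2 pi) := by
  have := h.1
  have hpos1 := h.ae_pos.mono fun _ hp => hp.1
  have hpos2 := h.ae_pos.mono fun _ hp => hp.2
  have hM := h.martingaleGiven hmu hnu
  have hφ := measurable_inv_prod_inv
  have hfst : (S2 pi).map Prod.fst = S mu := by
    rw [← h.2.2.1]
    exact hM.map_numeraire (v := id) measurable_snd hφ measurable_fst measurable_fst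
      measurable_inv measurable_id (fun _ => rfl) (fun _ => rfl)
      (hM.integral_eq measurable_fst measurable_snd hpos1 hpos2)
  have hsnd : (S2 pi).map Prod.snd = S nu := by
    rw [← h.2.2.2.1]
    exact map_numeraire (v := id) hφ measurable_snd measurable_snd measurable_snd
      measurable_inv measurable_id (fun _ => rfl) (fun _ => rfl)
  have hpos' : ∀ᵐ p ∂(S2 pi), 0 < p.1 ∧ 0 < p.2 :=
    ae_numeraire hφ ((measurableSet_lt measurable_const measurable_fst).inter
      (measurableSet_lt measurable_const measurable_snd))
      (h.ae_pos.mono fun p hp => by simpa using hp)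
  have hint1 : Integrable Prod.fst (S2 pi) := by
    have := hmu.map_S.2.2
    rw [← hfst] at this
    exact this.comp_measurable measurable_fst
  refine ⟨isProbabilityMeasure_numeraire measurable_snd hφ (h.integrable_snd hnu) hpos2, hpos',
    hfst, hsnd, ?_⟩
  refine (martingaleGiven_iff measurable_fst measurable_snd measurable_fst
    (hpos'.mono fun _ hp => hp.1) (hpos'.mono fun _ hp => hp.2) hint1
    (integrable_numeraire measurable_snd hφ (h.integrable_snd hnu) hpos2 fun _ => rfl)).1 ?_
  exact hM.numeraire (v := id) measurable_fst measurable_snd hφ measurable_fst measurable_inv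
    measurable_id (fun _ => rfl) (fun _ => rfl) (fun _ => rfl) (fun _ => rfl) hpos1 hpos2

theorem ae_memP1_disint (h : IsMC mu nu pi) (hmu : MemP1 mu) (hnu : MemP1 nu) :
    ∀ᵐ x ∂mu, MemP1 (disint pi x) ∧ bary (disint pi x) = x := by
  have := h.1
  have hfst : pi.fst = mu := h.2.2.1
  have h1 := (h.martingaleGiven hmu hnu).lintegral_condKernel measurable_snd
  have h2 := ae_ae_condKernel h.ae_pos
  rw [hfst] at h1 h2
  filter_upwards [h1, h2, hmu.ae_pos] with x hx1 hx2 hx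
  rw [disint_eq_condKernel]
  have hpos : ∀ᵐ b ∂(pi.condKernel x), 0 < b := hx2.mono fun b hb => hb.2
  refine ⟨⟨inferInstance, hpos, ?_⟩, ?_⟩
  · refine (lintegral_ofReal_ne_top_iff_integrable (f := id)
      measurable_id.aestronglyMeasurable (hpos.mono fun b hb => hb.le)).1 ?_
    exact hx1.trans_ne ENNReal.ofReal_ne_top
  · rw [bary, integral_eq_lintegral_of_nonneg_ae (hpos.mono fun b hb => hb.le)
      measurable_id.aestronglyMeasurable]
    exact (congrArg ENNReal.toReal hx1).trans (ENNReal.toReal_ofReal hx.le)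

theorem disint_S2 (h : IsMC mu nu pi) (hmu : MemP1 mu) (hnu : MemP1 nu) :
    ∀ᵐ x ∂mu, disint (S2 pi) x⁻¹ = S (disint pi x) := by
  have := h.1
  have hfst : pi.fst = mu := h.2.2.1
  have h1 := disint_numeraire measurable_snd measurable_inv (h.integrable_snd hnu)
    (h.ae_pos.mono fun _ hp => hp.2) (h.ae_pos.mono fun _ hp => hp.1) (h.martingaleGiven hmu hnu)
  rw [hfst] at h1
  filter_upwards [h1, h.ae_memP1_disint hmu hnu] with x hx hx'
  refine hx.trans ?_
  rw [S, hx'.2, disint_eq_condKernel]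

end IsMC

theorem disint_ShatMu {mu : Measure ℝ} (hmu : MemP1 mu) {mhat : Measure (ℝ × ℝ)}
    [IsProbabilityMeasure mhat] (hfst : mhat.map Prod.fst = mu) :
    ∀ᵐ x ∂mu, disint (ShatMu mhat) x⁻¹ = disint mhat x := by
  have hpos : ∀ᵐ p ∂mhat, 0 < p.1 :=
    ae_of_ae_map measurable_fst.aemeasurable (hfst ▸ hmu.ae_pos)
  have hint : Integrable Prod.fst mhat := by
    have := hmu.2.2
    rw [← hfst] at this
    exact this.comp_measurable measurable_fst
  have h1 := disint_numeraire (g := fun u : ℝ => u) measurable_fst measurable_id hint hpos hpos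
    fun _ _ => rfl
  rw [Measure.fst, hfst] at h1
  filter_upwards [h1, hmu.ae_pos] with x hx hx0
  refine hx.trans ?_
  rw [Measure.map_id', withDensity_const, smul_smul,
    ENNReal.inv_mul_cancel (by simpa using hx0) ENNReal.ofReal_ne_top, one_smul,
    disint_eq_condKernel]

theorem shadowVal_S2 {mu nu : Measure ℝ} {pi : Measure (ℝ × ℝ)} (h : IsMC mu nu pi)
    (hmu : MemP1 mu) (hnu : MemP1 nu) {mhat : Measure (ℝ × ℝ)} [IsProbabilityMeasure mhat]
    (hfst : mhat.map Prod.fst = mu) :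
    shadowVal (ShatMu mhat) (S mu) (S2 pi)
      = (ENNReal.ofReal (bary mu))⁻¹ * shadowVal mhat mu pi := by
  rw [shadowVal, S, lintegral_smul_measure, smul_eq_mul]
  congr 1
  -- `shadowCost` need not be measurable, so push forward along a measurable equivalence.
  refine (lintegral_map_equiv _ (MeasurableEquiv.inv ℝ)).trans ?_
  rw [lintegral_withDensity_eq_lintegral_mul_non_measurable _ (by fun_prop)
    (Filter.Eventually.of_forall fun _ => ENNReal.ofReal_lt_top)]
  refine lintegral_congr_ae ?_
  filter_upwards [h.ae_memP1_disint hmu hnu, h.disint_S2 hmu hnu, disint_ShatMu hmu hfst]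
    with x hx hx2 hx3
  have key := ofReal_mul_shadowCost_S (m := mhat) (m' := ShatMu mhat) hx.1
    (by rw [disint_eq_condKernel]; infer_instance) (by rw [hx.2, hx3])
  rw [hx.2] at key
  rw [← key, ← hx2]
  rfl

end ChangeOfNumeraire

/-- `π ∈ M(μ,ν)` minimizes the shadow-cost problem with source `μ̂` iff
`S(π)` minimizes the shadow-cost problem between `S(μ)` and `S(ν)` with source `Ŝ(μ̂)`;
in particular the unique minimizer (the shadow coupling) is mapped to the unique
minimizer. -/
theorem stmt18 (mu nu : Measure ℝ) (hmu : MemP1 mu) (hnu : MemP1 nu)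
    (hcvx : ConvexOrder mu nu)
    (mhat : Measure (ℝ × ℝ)) (hmp : IsProbabilityMeasure mhat)
    (hmc : mhat {p : ℝ × ℝ | 0 < p.1 ∧ p.2 ∈ Set.Icc (0:ℝ) 1}ᶜ = 0)
    (hfst : mhat.map Prod.fst = mu)
    (hatomless : ∀ u : ℝ, mhat.map Prod.snd {u} = 0) :
    (∀ pi, IsMC mu nu pi →
      ((∀ pi', IsMC mu nu pi' → shadowVal mhat mu pi ≤ shadowVal mhat mu pi') ↔
       (∀ rho, IsMC (S mu) (S nu) rho →
          shadowVal (ShatMu mhat) (S mu) (S2 pi) ≤ shadowVal (ShatMu mhat) (S mu) rho))) ∧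
    (∀ pi, IsMC mu nu pi →
      (∀ pi', IsMC mu nu pi' → shadowVal mhat mu pi ≤ shadowVal mhat mu pi') →
      (∀ pi', IsMC mu nu pi' →
        (∀ pi'', IsMC mu nu pi'' → shadowVal mhat mu pi' ≤ shadowVal mhat mu pi'') →
        pi' = pi) →
      ((∀ rho, IsMC (S mu) (S nu) rho →
          shadowVal (ShatMu mhat) (S mu) (S2 pi) ≤ shadowVal (ShatMu mhat) (S mu) rho) ∧
       (∀ rho, IsMC (S mu) (S nu) rho →
          (∀ rho', IsMC (S mu) (S nu) rho' →
            shadowVal (ShatMu mhat) (S mu) rho ≤ shadowVal (ShatMu mhat) (S mu) rho') →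
          rho = S2 pi))) := by
  have hb : ENNReal.ofReal (bary mu) ≠ 0 := by simpa using hmu.bary_pos
  have hval : ∀ pi pi', IsMC mu nu pi → IsMC mu nu pi' →
      (shadowVal (ShatMu mhat) (S mu) (S2 pi) ≤ shadowVal (ShatMu mhat) (S mu) (S2 pi') ↔
        shadowVal mhat mu pi ≤ shadowVal mhat mu pi') := by
    intro pi pi' h h'
    rw [shadowVal_S2 h hmu hnu hfst, shadowVal_S2 h' hmu hnu hfst]
    exact ENNReal.mul_le_mul_iff_right (ENNReal.inv_ne_zero.2 ENNReal.ofReal_ne_top)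
      (ENNReal.inv_ne_top.2 hb)
  have hback : ∀ rho, IsMC (S mu) (S nu) rho → IsMC mu nu (S2 rho) ∧ S2 (S2 rho) = rho := by
    intro rho h
    have h1 := h.map_S2 hmu.map_S hnu.map_S
    rw [hmu.S_S, hnu.S_S] at h1
    exact ⟨h1, h.S2_S2 hnu.map_S⟩
  have hmin : ∀ pi, IsMC mu nu pi →
      ((∀ pi', IsMC mu nu pi' → shadowVal mhat mu pi ≤ shadowVal mhat mu pi') ↔
       (∀ rho, IsMC (S mu) (S nu) rho →
          shadowVal (ShatMu mhat) (S mu) (S2 pi) ≤ shadowVal (ShatMu mhat) (S mu) rho)) := by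
    intro pi h
    constructor
    · intro H rho hrho
      obtain ⟨h1, h2⟩ := hback rho hrho
      rw [← h2]
      exact (hval _ _ h h1).2 (H _ h1)
    · intro H pi' h'
      exact (hval _ _ h h').1 (H _ (h'.map_S2 hmu hnu))
  refine ⟨hmin, fun pi h H huniq => ⟨(hmin pi h).1 H, fun rho hrho Hrho => ?_⟩⟩
  obtain ⟨h1, h2⟩ := hback rho hrho
  rw [← h2] at Hrho
  rw [← huniq _ h1 ((hmin _ h1).2 Hrho), h2]
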